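/- Let L be a first-order language, M an L-structure, and I, J finite linear orders with |I|, |J| ≥ 3. Let μ and μ' be regular (I,J)-meshes in M such that the pair (μ,μ') is regular. Then one of the following holds: (1) μ and μ' are both pseudo-vertical; (2) μ and μ' are both pseudo-horizontal; (3) the pair (μ,μ') is quasi-homogeneous. -/

import Mathlib

open FirstOrder

/-- Pairs `(u,v)` and `(u',v')` of elements of the `L`-structure `M` have the same
atomic type if every atomic `L`-formula in two free variables holds of `(u,v)`
iff it holds of `(u',v')`. -/
def AtpEqFO (L : Language) {M : Type*} [L.Structure M] (u v u' v' : M) : Prop :=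
  ∀ φ : L.Formula (Fin 2), φ.IsAtomic →
    (φ.Realize ![u, v] ↔ φ.Realize ![u', v'])

/-- A pair `(μ, μ')` of `(I,J)`-meshes is regular if the atomic type of
`(μ(i,j), μ'(i',j'))` depends only on the order types of `(i,i')` and `(j,j')`. -/
def IsRegularPairFO (L : Language) {M : Type*} [L.Structure M]
    {I J : Type*} [LinearOrder I] [LinearOrder J] (μ μ' : I × J → M) : Prop :=
  ∀ (i₁ i₁' i₂ i₂' : I) (j₁ j₁' j₂ j₂' : J),
    cmp i₁ i₁' = cmp i₂ i₂' → cmp j₁ j₁' = cmp j₂ j₂' →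
    AtpEqFO L (μ (i₁, j₁)) (μ' (i₁', j₁')) (μ (i₂, j₂)) (μ' (i₂', j₂'))

/-- A pair `(μ, μ')` of `(I,J)`-meshes is homogeneous if the atomic type of
`(μ(i,j), μ'(i',j'))` is the same for all `i, i', j, j'`. -/
def IsHomogeneousPairFO (L : Language) {M : Type*} [L.Structure M]
    {I J : Type*} [LinearOrder I] [LinearOrder J] (μ μ' : I × J → M) : Prop :=
  ∀ (i₁ i₁' i₂ i₂' : I) (j₁ j₁' j₂ j₂' : J),
    AtpEqFO L (μ (i₁, j₁)) (μ' (i₁', j₁')) (μ (i₂, j₂)) (μ' (i₂', j₂'))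

/-- A pair `(μ, μ')` of `(I,J)`-meshes is quasi-homogeneous if it is regular and the atomic
type of `(μ(i,j), μ'(i',j'))` is the same for all `(i,j) ≠ (i',j')`. -/
def IsQuasiHomogeneousPairFO (L : Language) {M : Type*} [L.Structure M]
    {I J : Type*} [LinearOrder I] [LinearOrder J] (μ μ' : I × J → M) : Prop :=
  IsRegularPairFO L μ μ' ∧
  ∀ (i₁ i₁' i₂ i₂' : I) (j₁ j₁' j₂ j₂' : J),
    (i₁, j₁) ≠ (i₁', j₁') → (i₂, j₂) ≠ (i₂', j₂') →
    AtpEqFO L (μ (i₁, j₁)) (μ' (i₁', j₁')) (μ (i₂, j₂)) (μ' (i₂', j₂'))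

/-- An `(I,J)`-mesh is vertical if there is a function `a : I → M` (a vertical guard)
such that `atp(μ(i,j), a(i'))` depends only on `otp(i,i')` and is not the same for all
`i, i' ∈ I` and `j ∈ J`. -/
def IsVerticalFO (L : Language) {M : Type*} [L.Structure M]
    {I J : Type*} [LinearOrder I] [LinearOrder J] (μ : I × J → M) : Prop :=
  ∃ a : I → M,
    (∀ (i i' i₂ i₂' : I) (j j₂ : J), cmp i i' = cmp i₂ i₂' →
      AtpEqFO L (μ (i, j)) (a i') (μ (i₂, j₂)) (a i₂')) ∧
    ¬ ∀ (i i' i₂ i₂' : I) (j j₂ : J),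
      AtpEqFO L (μ (i, j)) (a i') (μ (i₂, j₂)) (a i₂')

/-- An `(I,J)`-mesh is horizontal if there is a function `b : J → M` (a horizontal guard)
such that `atp(μ(i,j), b(j'))` depends only on `otp(j,j')` and is not the same for all
`j, j' ∈ J` and `i ∈ I`. -/
def IsHorizontalFO (L : Language) {M : Type*} [L.Structure M]
    {I J : Type*} [LinearOrder I] [LinearOrder J] (μ : I × J → M) : Prop :=
  ∃ b : J → M,
    (∀ (j j' j₂ j₂' : J) (i i₂ : I), cmp j j' = cmp j₂ j₂' →
      AtpEqFO L (μ (i, j)) (b j') (μ (i₂, j₂)) (b j₂')) ∧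
    ¬ ∀ (j j' j₂ j₂' : J) (i i₂ : I),
      AtpEqFO L (μ (i, j)) (b j') (μ (i₂, j₂)) (b j₂')

/-- The set of elements of a finite nonempty linear order distinct from the minimum
and the maximum. -/
def innerSet (J : Type*) [LinearOrder J] [Fintype J] [Nonempty J] : Set J :=
  {j | j ≠ Finset.univ.min' Finset.univ_nonempty ∧
       j ≠ Finset.univ.max' Finset.univ_nonempty}

/-- A mesh is pseudo-vertical if it is regular and its restriction to
`I × (J \ {min J, max J})` is vertical. -/
def IsPseudoVerticalFO (L : Language) {M : Type*} [L.Structure M]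
    {I J : Type*} [LinearOrder I] [LinearOrder J] [Fintype J] [Nonempty J]
    (μ : I × J → M) : Prop :=
  IsRegularPairFO L μ μ ∧
  IsVerticalFO L (fun p : I × ↥(innerSet J) => μ (p.1, ↑p.2))

/-- A mesh is pseudo-horizontal if it is regular and its restriction to
`(I \ {min I, max I}) × J` is horizontal. -/
def IsPseudoHorizontalFO (L : Language) {M : Type*} [L.Structure M]
    {I J : Type*} [LinearOrder I] [LinearOrder J] [Fintype I] [Nonempty I]
    (μ : I × J → M) : Prop :=
  IsRegularPairFO L μ μ ∧
  IsHorizontalFO L (fun p : ↥(innerSet I) × J => μ (↑p.1, p.2))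

namespace AtpEqFO

variable {L : Language} {M : Type*} [L.Structure M] {u v u' v' u'' v'' : M}

theorem symm (h : AtpEqFO L u v u' v') : AtpEqFO L u' v' u v :=
  fun φ hφ => (h φ hφ).symm

theorem trans (h : AtpEqFO L u v u' v') (k : AtpEqFO L u' v' u'' v'') :
    AtpEqFO L u v u'' v'' :=
  fun φ hφ => (h φ hφ).trans (k φ hφ)

/-- Exchanging the two components of both pairs preserves equality of atomic types. -/
theorem swap (h : AtpEqFO L u v u' v') : AtpEqFO L v u v' u' := by
  intro φ hφ
  have key : ∀ x y : M, (φ.relabel (Equiv.swap (0 : Fin 2) 1)).Realize ![x, y] ↔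
      φ.Realize ![y, x] := by
    intro x y
    rw [Language.Formula.realize_relabel]
    have : ![x, y] ∘ (Equiv.swap (0 : Fin 2) 1) = ![y, x] := by
      funext k
      fin_cases k <;> simp
    rw [this]
  rw [← key, ← key]
  exact h _ (hφ.relabel _)

end AtpEqFO

section Meshes

variable {L : Language} {M : Type*} [L.Structure M]
  {I J : Type*} [LinearOrder I] [LinearOrder J]

/-- Off the diagonal of `J`, the atomic type of `(μ(i,j), μ'(i',j'))` depends only on
the order type of `(j,j')`. -/
def AtpDependsOnSnd (L : Language) {M : Type*} [L.Structure M]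
    {I J : Type*} [LinearOrder J] (μ μ' : I × J → M) : Prop :=
  ∀ (i₁ i₁' i₂ i₂' : I) (j₁ j₁' j₂ j₂' : J), j₁ ≠ j₁' → cmp j₁ j₁' = cmp j₂ j₂' →
    AtpEqFO L (μ (i₁, j₁)) (μ' (i₁', j₁')) (μ (i₂, j₂)) (μ' (i₂', j₂'))

theorem IsRegularPairFO.swap {μ μ' : I × J → M} (h : IsRegularPairFO L μ μ') :
    IsRegularPairFO L μ' μ :=
  fun _ _ _ _ _ _ _ _ hi hj =>
    (h _ _ _ _ _ _ _ _ (cmp_eq_cmp_symm.1 hi) (cmp_eq_cmp_symm.1 hj)).swap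

theorem AtpDependsOnSnd.swap {I J : Type*} [LinearOrder J] {μ μ' : I × J → M}
    (h : AtpDependsOnSnd L μ μ') :
    AtpDependsOnSnd L μ' μ :=
  fun _ _ _ _ _ _ _ _ hne hj =>
    (h _ _ _ _ _ _ _ _ hne.symm (cmp_eq_cmp_symm.1 hj)).swap

/-- Exchanging the two coordinates of both meshes preserves regularity of the pair. -/
theorem IsRegularPairFO.comp_swap {μ μ' : I × J → M} (h : IsRegularPairFO L μ μ') :
    IsRegularPairFO L (μ ∘ Prod.swap) (μ' ∘ Prod.swap) :=
  fun _ _ _ _ _ _ _ _ hj hi => h _ _ _ _ _ _ _ _ hi hj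

theorem lt_max_of_mem_innerSet [Fintype J] [Nonempty J] {j : J} (hj : j ∈ innerSet J) :
    j < Finset.univ.max' Finset.univ_nonempty :=
  lt_of_le_of_ne (Finset.le_max' _ _ (Finset.mem_univ j)) hj.2

theorem min_lt_of_mem_innerSet [Fintype J] [Nonempty J] {j : J} (hj : j ∈ innerSet J) :
    Finset.univ.min' Finset.univ_nonempty < j :=
  lt_of_le_of_ne (Finset.min'_le _ _ (Finset.mem_univ j)) (Ne.symm hj.1)

theorem innerSet_nonempty [Fintype J] [Nonempty J] (hJ : 3 ≤ Fintype.card J) :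
    (innerSet J).Nonempty := by
  classical
  have hcard : ({Finset.univ.min' Finset.univ_nonempty,
      Finset.univ.max' Finset.univ_nonempty} : Finset J).card < Fintype.card J :=
    lt_of_le_of_lt Finset.card_le_two (by omega)
  obtain ⟨j, hj⟩ := Finset.exists_mem_notMem_of_card_lt_card
    (s := {Finset.univ.min' Finset.univ_nonempty, Finset.univ.max' Finset.univ_nonempty})
    (t := (Finset.univ : Finset J)) (by simpa using hcard)
  refine ⟨j, ?_⟩
  simpa [innerSet] using hj.2

/-- A row of `μ'` lying strictly on one side of the nonempty set `S` of rows is a vertical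
guard for the restriction of `μ` to `S`, provided that the atomic type of `(μ(i,j), μ'(i',j'))`
on that side is not constant. -/
theorem IsRegularPairFO.isVerticalFO_restrict {μ μ' : I × J → M} (h : IsRegularPairFO L μ μ')
    {S : Set J} (hS : S.Nonempty) {m : J} {i₁ i₁' i₂ i₂' : I} {j₁ j₁' j₂ j₂' : J}
    (hm : ∀ j ∈ S, cmp j m = cmp j₁ j₁') (hj : cmp j₁ j₁' = cmp j₂ j₂')
    (hne : ¬ AtpEqFO L (μ (i₁, j₁)) (μ' (i₁', j₁')) (μ (i₂, j₂)) (μ' (i₂', j₂'))) :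
    IsVerticalFO L (fun p : I × S => μ (p.1, ↑p.2)) := by
  obtain ⟨s, hs⟩ := hS
  refine ⟨fun i => μ' (i, m), fun i i' k k' j j' hc => ?_, fun hconst => hne ?_⟩
  · exact h _ _ _ _ _ _ _ _ hc ((hm _ j.2).trans (hm _ j'.2).symm)
  · exact ((h _ _ _ _ _ _ _ _ rfl (hm s hs).symm).trans
      (hconst i₁ i₁' i₂ i₂' ⟨s, hs⟩ ⟨s, hs⟩)).trans
      (h _ _ _ _ _ _ _ _ rfl ((hm s hs).trans hj))

theorem IsRegularPairFO.isVerticalFO_innerSet [Fintype J] [Nonempty J]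
    (hJ : 3 ≤ Fintype.card J) {μ μ' : I × J → M} (h : IsRegularPairFO L μ μ')
    (hdep : ¬ AtpDependsOnSnd L μ μ') :
    IsVerticalFO L (fun p : I × ↥(innerSet J) => μ (p.1, ↑p.2)) := by
  simp only [AtpDependsOnSnd, not_forall] at hdep
  obtain ⟨i₁, i₁', i₂, i₂', j₁, j₁', j₂, j₂', hne, hj, hatp⟩ := hdep
  rcases lt_or_gt_of_ne hne with hlt | hgt
  · refine h.isVerticalFO_restrict (m := Finset.univ.max' Finset.univ_nonempty)
      (innerSet_nonempty hJ) (fun j hmem => ?_) hj hatp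
    rw [(lt_max_of_mem_innerSet hmem).cmp_eq_lt, hlt.cmp_eq_lt]
  · refine h.isVerticalFO_restrict (m := Finset.univ.min' Finset.univ_nonempty)
      (innerSet_nonempty hJ) (fun j hmem => ?_) hj hatp
    rw [(min_lt_of_mem_innerSet hmem).cmp_eq_gt, hgt.cmp_eq_gt]

theorem isHorizontalFO_of_isVerticalFO_swap {μ : I × J → M}
    (h : IsVerticalFO L (fun p : J × I => μ (p.2, p.1))) : IsHorizontalFO L μ :=
  h

theorem IsRegularPairFO.isQuasiHomogeneousPairFO [Nontrivial I] [Nontrivial J]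
    {μ μ' : I × J → M} (h : IsRegularPairFO L μ μ') (hsnd : AtpDependsOnSnd L μ μ')
    (hfst : AtpDependsOnSnd L (μ ∘ Prod.swap) (μ' ∘ Prod.swap)) :
    IsQuasiHomogeneousPairFO L μ μ' := by
  obtain ⟨a, b, hab⟩ := exists_pair_lt I
  obtain ⟨c, d, hcd⟩ := exists_pair_lt J
  have key : ∀ (i i' : I) (j j' : J), (i, j) ≠ (i', j') →
      AtpEqFO L (μ (i, j)) (μ' (i', j')) (μ (a, c)) (μ' (b, d)) := by
    intro i i' j j' hne
    rcases lt_trichotomy j j' with hj | rfl | hj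
    · exact hsnd _ _ _ _ _ _ _ _ hj.ne (by rw [hj.cmp_eq_lt, hcd.cmp_eq_lt])
    · have hi : i ≠ i' := fun e => hne (by rw [e])
      rcases lt_or_gt_of_ne hi with hi | hi
      · exact hfst _ _ _ _ _ _ _ _ hi.ne (by rw [hi.cmp_eq_lt, hab.cmp_eq_lt])
      · have h₁ : AtpEqFO L (μ (i, j)) (μ' (i', j)) (μ (b, c)) (μ' (a, d)) :=
          hfst _ _ _ _ _ _ _ _ hi.ne' (by rw [hi.cmp_eq_gt, hab.cmp_eq_gt])
        exact h₁.trans (hsnd _ _ _ _ _ _ _ _ hcd.ne rfl)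
    · have h₁ : AtpEqFO L (μ (i, j)) (μ' (i', j')) (μ (a, d)) (μ' (b, c)) :=
        hsnd _ _ _ _ _ _ _ _ hj.ne' (by rw [hj.cmp_eq_gt, hcd.cmp_eq_gt])
      exact h₁.trans (hfst _ _ _ _ _ _ _ _ hab.ne rfl)
  exact ⟨h, fun _ _ _ _ _ _ _ _ hne hne' => (key _ _ _ _ hne).trans (key _ _ _ _ hne').symm⟩

end Meshes

theorem stmt6 {L : Language} {M : Type*} [L.Structure M]
    {I J : Type*} [LinearOrder I] [LinearOrder J]
    [Fintype I] [Fintype J] [Nonempty I] [Nonempty J]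
    (hI : 3 ≤ Fintype.card I) (hJ : 3 ≤ Fintype.card J)
    (μ μ' : I × J → M) (hμ : Function.Injective μ) (hμ' : Function.Injective μ')
    (hpair : IsRegularPairFO L μ μ')
    (hself : IsRegularPairFO L μ μ) (hself' : IsRegularPairFO L μ' μ') :
    (IsPseudoVerticalFO L μ ∧ IsPseudoVerticalFO L μ') ∨
    (IsPseudoHorizontalFO L μ ∧ IsPseudoHorizontalFO L μ') ∨
    IsQuasiHomogeneousPairFO L μ μ' := by
  by_cases hsnd : AtpDependsOnSnd L μ μ'
  · by_cases hfst : AtpDependsOnSnd L (μ ∘ Prod.swap) (μ' ∘ Prod.swap)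
    · have : Nontrivial I := Fintype.one_lt_card_iff_nontrivial.1 (by omega)
      have : Nontrivial J := Fintype.one_lt_card_iff_nontrivial.1 (by omega)
      exact .inr (.inr (hpair.isQuasiHomogeneousPairFO hsnd hfst))
    · exact .inr (.inl
        ⟨⟨hself, isHorizontalFO_of_isVerticalFO_swap
          (hpair.comp_swap.isVerticalFO_innerSet hI hfst)⟩,
        ⟨hself', isHorizontalFO_of_isVerticalFO_swap
          (hpair.swap.comp_swap.isVerticalFO_innerSet hI fun h => hfst h.swap)⟩⟩)
  · exact .inl ⟨⟨hself, hpair.isVerticalFO_innerSet hJ hsnd⟩,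
      ⟨hself', hpair.swap.isVerticalFO_innerSet hJ fun h => hsnd h.swap⟩⟩
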